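/- arXiv:0902.4129 — 7 statements merged into one kernel-verified Lean document; each statement's English description precedes it below -/
import Mathlib

section
/- Let J be the 4×4 real matrix with J₁₄ = J₂₃ = 1, J₃₂ = J₄₁ = −1 and zeros elsewhere, and Sp(4,ℝ) = {h ∈ GL₄(ℝ) : hᵀ J h = J}. For real parameters u₁ > 0, u₃ ≠ 0, u₂, u₄, u₅, u₆ ∈ ℝ, let h(u₁,…,u₆) be the upper triangular matrix with rows [√u₁, u₂/(2√u₁), −u₄/(2√u₁), u₂²u₅/(24 u₁^{3/2} u₃) − (1/2)√u₁·u₆], [0, u₃/√u₁, −u₅/√u₁, (u₂u₅ − u₃u₄)/(2 u₁^{3/2})], [0, 0, √u₁/u₃, −u₂/(2√u₁·u₃)], [0, 0, 0, 1/√u₁]. Then every such h(u₁,…,u₆) belongs to Sp(4,ℝ), and the set H₆ of all these matrices is a six-parameter subgroup of Sp(4,ℝ): it is closed under matrix multiplication and inversion. In fact H₆ equals the set of all upper triangular matrices in Sp(4,ℝ) whose (1,1) entry is positive. -/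
open Matrix

/-- The symplectic form `J` with `J₁₄ = J₂₃ = 1`, `J₃₂ = J₄₁ = −1`. -/
def Jmat : Matrix (Fin 4) (Fin 4) ℝ := !![0,0,0,1; 0,0,1,0; 0,-1,0,0; -1,0,0,0]

/-- The matrix `h(u₁,…,u₆)` of the structure group `H₆` of the bundle `H₆ → Pᶜ → J²`. -/
noncomputable def hMat (u₁ u₂ u₃ u₄ u₅ u₆ : ℝ) : Matrix (Fin 4) (Fin 4) ℝ :=
  !![Real.sqrt u₁, u₂ / (2 * Real.sqrt u₁), -u₄ / (2 * Real.sqrt u₁),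
       u₂ ^ 2 * u₅ / (24 * (u₁ * Real.sqrt u₁) * u₃) - (1 / 2) * Real.sqrt u₁ * u₆;
     0, u₃ / Real.sqrt u₁, -u₅ / Real.sqrt u₁,
       (u₂ * u₅ - u₃ * u₄) / (2 * (u₁ * Real.sqrt u₁));
     0, 0, Real.sqrt u₁ / u₃, -u₂ / (2 * Real.sqrt u₁ * u₃);
     0, 0, 0, 1 / Real.sqrt u₁]

/-- The set `H₆` of all matrices `h(u₁,…,u₆)` with `u₁ > 0`, `u₃ ≠ 0`. -/
noncomputable def H₆ : Set (Matrix (Fin 4) (Fin 4) ℝ) :=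
  {m | ∃ u₁ u₂ u₃ u₄ u₅ u₆ : ℝ, 0 < u₁ ∧ u₃ ≠ 0 ∧ m = hMat u₁ u₂ u₃ u₄ u₅ u₆}

theorem hMat_transpose_mul_Jmat_mul {u₁ u₃ : ℝ} (u₂ u₄ u₅ u₆ : ℝ) (h₁ : 0 < u₁) (h₃ : u₃ ≠ 0) :
    (hMat u₁ u₂ u₃ u₄ u₅ u₆)ᵀ * Jmat * hMat u₁ u₂ u₃ u₄ u₅ u₆ = Jmat := by
  obtain ⟨s, hs, rfl⟩ : ∃ s : ℝ, 0 < s ∧ u₁ = s ^ 2 :=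
    ⟨√u₁, Real.sqrt_pos.2 h₁, (Real.sq_sqrt h₁.le).symm⟩
  ext i j
  fin_cases i <;> fin_cases j <;>
    simp [hMat, Jmat, Matrix.mul_apply, Fin.sum_univ_four, Real.sqrt_sq hs.le] <;>
    field_simp <;> ring

theorem mem_H₆_iff {h : Matrix (Fin 4) (Fin 4) ℝ} :
    h ∈ H₆ ↔ hᵀ * Jmat * h = Jmat ∧ (∀ i j : Fin 4, j < i → h i j = 0) ∧ 0 < h 0 0 := by
  constructor
  · rintro ⟨u₁, u₂, u₃, u₄, u₅, u₆, h₁, h₃, rfl⟩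
    refine ⟨hMat_transpose_mul_Jmat_mul _ _ _ _ h₁ h₃, ?_, by simpa [hMat] using h₁⟩
    intro i j hij
    fin_cases i <;> fin_cases j <;> first | exact absurd hij (by decide) | simp [hMat]
  · rintro ⟨hJ, ht, ha⟩
    have h10 := ht 1 0 (by decide)
    have h20 := ht 2 0 (by decide)
    have h30 := ht 3 0 (by decide)
    have h21 := ht 2 1 (by decide)
    have h31 := ht 3 1 (by decide)
    have h32 := ht 3 2 (by decide)
    have e03 := congrFun (congrFun hJ 0) 3
    have e12 := congrFun (congrFun hJ 1) 2
    have e13 := congrFun (congrFun hJ 1) 3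
    have e23 := congrFun (congrFun hJ 2) 3
    simp [Jmat, Matrix.mul_apply, Fin.sum_univ_four, h10, h20, h30, h21, h31, h32]
      at e03 e12 e13 e23
    have he : h 1 1 ≠ 0 := left_ne_zero_of_mul_eq_one e12
    have h33 : h 3 3 = 1 / h 0 0 := by field_simp; linarith
    have h22 : h 2 2 = 1 / h 1 1 := by field_simp; linarith
    have h23 : h 2 3 = -(h 0 1 * h 3 3) / h 1 1 := by field_simp; linarith
    have h13 : h 1 3 = h 1 1 * (h 0 2 * h 3 3 + h 1 2 * h 2 3) := by
      rw [h22] at e23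
      field_simp at e23
      linarith
    refine ⟨h 0 0 ^ 2, 2 * h 0 0 * h 0 1, h 1 1 * h 0 0, -(2 * h 0 0 * h 0 2), -(h 1 2 * h 0 0),
      (-(2 * h 0 0 * h 0 1) ^ 2 * (h 1 2 * h 0 0) / (24 * h 0 0 ^ 3 * (h 1 1 * h 0 0)) - h 0 3)
        * 2 / h 0 0, by positivity, by positivity, ?_⟩
    ext i j
    fin_cases i <;> fin_cases j <;>
      simp [hMat, Real.sqrt_sq ha.le, h10, h20, h30, h21, h31, h32, h13, h23, h22, h33] <;>
      field_simp <;> ring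

theorem H₆_mul_mem {m₁ m₂ : Matrix (Fin 4) (Fin 4) ℝ} (h₁ : m₁ ∈ H₆) (h₂ : m₂ ∈ H₆) :
    m₁ * m₂ ∈ H₆ := by
  rw [mem_H₆_iff] at *
  obtain ⟨hJ₁, ht₁, hp₁⟩ := h₁
  obtain ⟨hJ₂, ht₂, hp₂⟩ := h₂
  refine ⟨?_, ?_, ?_⟩
  · calc (m₁ * m₂)ᵀ * Jmat * (m₁ * m₂) = m₂ᵀ * (m₁ᵀ * Jmat * m₁) * m₂ := by
          simp only [Matrix.transpose_mul, Matrix.mul_assoc]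
      _ = Jmat := by rw [hJ₁, hJ₂]
  · exact Matrix.BlockTriangular.mul (b := id) (fun i j => ht₁ i j) (fun i j => ht₂ i j)
  · simpa [Matrix.mul_apply, Fin.sum_univ_four, ht₂ 1 0 (by decide), ht₂ 2 0 (by decide),
      ht₂ 3 0 (by decide)] using mul_pos hp₁ hp₂

theorem Jmat_mul_Jmat : Jmat * Jmat = -1 := by
  ext i j
  fin_cases i <;> fin_cases j <;> simp [Jmat, Matrix.mul_apply, Fin.sum_univ_four]

theorem exists_inverse_mem_H₆ {m : Matrix (Fin 4) (Fin 4) ℝ} (hm : m ∈ H₆) :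
    ∃ m' ∈ H₆, m * m' = 1 ∧ m' * m = 1 := by
  rw [mem_H₆_iff] at hm
  obtain ⟨hJ, ht, hp⟩ := hm
  have hl : -(Jmat * mᵀ * Jmat) * m = 1 := by
    rw [Matrix.neg_mul, Matrix.mul_assoc Jmat, Matrix.mul_assoc Jmat, hJ, Jmat_mul_Jmat, neg_neg]
  have hr := mul_eq_one_comm.1 hl
  refine ⟨-(Jmat * mᵀ * Jmat), mem_H₆_iff.2 ⟨?_, ?_, ?_⟩, hr, hl⟩
  · generalize -(Jmat * mᵀ * Jmat) = n at hr
    calc nᵀ * Jmat * n = nᵀ * (mᵀ * Jmat * m) * n := by rw [hJ]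
      _ = (m * n)ᵀ * Jmat * (m * n) := by
          simp only [Matrix.transpose_mul, Matrix.mul_assoc]
      _ = Jmat := by simp [hr]
  · intro i j hij
    fin_cases i <;> fin_cases j <;> first
      | exact absurd hij (by decide)
      | (simp only [Matrix.neg_apply, Matrix.mul_apply, Fin.sum_univ_four]; simp [Jmat, ht])
  · have e := congrFun (congrFun hJ 0) 3
    simp [Jmat, Matrix.mul_apply, Fin.sum_univ_four, ht] at e
    have : 0 < m 3 3 := pos_of_mul_pos_right (e ▸ one_pos) hp.le
    simp only [Matrix.neg_apply, Matrix.mul_apply, Fin.sum_univ_four]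
    simpa [Jmat] using this

/-- every `h(u₁,…,u₆)` is symplectic, `H₆` is closed under multiplication
and inversion, and `H₆` is exactly the set of upper triangular symplectic matrices with
positive `(1,1)` entry. -/
theorem H6_subgroup_of_Sp4 :
    (∀ u₁ u₂ u₃ u₄ u₅ u₆ : ℝ, 0 < u₁ → u₃ ≠ 0 →
      (hMat u₁ u₂ u₃ u₄ u₅ u₆)ᵀ * Jmat * hMat u₁ u₂ u₃ u₄ u₅ u₆ = Jmat) ∧
    (∀ m₁ ∈ H₆, ∀ m₂ ∈ H₆, m₁ * m₂ ∈ H₆) ∧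
    (∀ m ∈ H₆, ∃ m' ∈ H₆, m * m' = 1 ∧ m' * m = 1) ∧
    H₆ = {h : Matrix (Fin 4) (Fin 4) ℝ |
      hᵀ * Jmat * h = Jmat ∧ (∀ i j : Fin 4, j < i → h i j = 0) ∧ 0 < h 0 0} := by
  exact ⟨fun _ u₂ _ u₄ u₅ u₆ h₁ h₃ => hMat_transpose_mul_Jmat_mul u₂ u₄ u₅ u₆ h₁ h₃,
    fun _ h₁ _ h₂ => H₆_mul_mem h₁ h₂, fun _ hm => exists_inverse_mem_H₆ hm,
    Set.ext fun _ => mem_H₆_iff⟩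
end

section
/- Fix μ ∈ ℝ and let F(x,y,p,q) = −2μp + y on ℝ⁴, so that y''' = F is the linear equation y''' = −2μy' + y. Then, with 𝒟 = ∂_x + p∂_y + q∂_p + F∂_q, K = (1/6)𝒟(F_q) − (1/9)F_q² − (1/2)F_p, W = 𝒟(K) − (2/3)F_q·K + F_y and Z = 𝒟(W)/W − F_q, the following identities hold identically on ℝ⁴: K ≡ μ, W ≡ 1 (in particular W ≠ 0 everywhere), Z ≡ 0, the contact invariant a[F] = W^{−2/3}·(K + Z²/18 + Z·F_q/9 − 𝒟(Z)/3) ≡ μ, and 2W_q² − 3W_{qq}·W ≡ 0. Hence y''' = −2μy' + y satisfies the three conditions W ≠ 0, a[F] = μ and 2W_q² − 3W_{qq}W = 0 characterizing, up to contact equivalence, the homogeneous models with symmetry algebra ℝ² ⋉_μ ℝ³. -/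
noncomputable section

/-- The total derivative vector `(1, p, q, F(z))` at `z = (x,y,p,q)`. -/
def Dvec (F : (Fin 4 → ℝ) → ℝ) (z : Fin 4 → ℝ) : Fin 4 → ℝ := ![1, z 2, z 3, F z]

/-- The total derivative operator `𝒟 = ∂_x + p∂_y + q∂_p + F∂_q`. -/
def Dop (F G : (Fin 4 → ℝ) → ℝ) (z : Fin 4 → ℝ) : ℝ := fderiv ℝ G z (Dvec F z)

/-- Partial derivative in the `i`-th coordinate direction (`0,1,2,3 ↔ x,y,p,q`). -/
def pd (i : Fin 4) (G : (Fin 4 → ℝ) → ℝ) (z : Fin 4 → ℝ) : ℝ := fderiv ℝ G z (Pi.single i 1)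

/-- `K = (1/6)𝒟(F_q) − (1/9)F_q² − (1/2)F_p`. -/
def Kf (F : (Fin 4 → ℝ) → ℝ) (z : Fin 4 → ℝ) : ℝ :=
  (1 / 6) * Dop F (pd 3 F) z - (1 / 9) * (pd 3 F z) ^ 2 - (1 / 2) * pd 2 F z

/-- The Wünschmann invariant `W = 𝒟(K) − (2/3)F_q·K + F_y`. -/
def Wf (F : (Fin 4 → ℝ) → ℝ) (z : Fin 4 → ℝ) : ℝ :=
  Dop F (Kf F) z - (2 / 3) * pd 3 F z * Kf F z + pd 1 F z

/-- `Z = 𝒟(W)/W − F_q`. -/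
def Zf (F : (Fin 4 → ℝ) → ℝ) (z : Fin 4 → ℝ) : ℝ := Dop F (Wf F) z / Wf F z - pd 3 F z

/-- The contact invariant `a[F] = W^{−2/3}·(K + Z²/18 + Z·F_q/9 − 𝒟(Z)/3)`. -/
def aInv (F : (Fin 4 → ℝ) → ℝ) (z : Fin 4 → ℝ) : ℝ :=
  Wf F z ^ (-(2 : ℝ) / 3) *
    (Kf F z + (Zf F z) ^ 2 / 18 + Zf F z * pd 3 F z / 9 - Dop F (Zf F) z / 3)

/-- The right-hand side of the linear equation `y''' = −2μy' + y`. -/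
def Flin (μ : ℝ) (z : Fin 4 → ℝ) : ℝ := -2 * μ * z 2 + z 1

theorem Dop_const (F : (Fin 4 → ℝ) → ℝ) (c : ℝ) : Dop F (fun _ => c) = fun _ => 0 := by
  funext z
  simp [Dop]

theorem pd_const (i : Fin 4) (c : ℝ) : pd i (fun _ => c) = fun _ => 0 := by
  funext z
  simp [pd]

theorem pd_Flin (μ : ℝ) (i : Fin 4) :
    pd i (Flin μ) = fun _ => -2 * μ * (Pi.single i 1 : Fin 4 → ℝ) 2 +
      (Pi.single i 1 : Fin 4 → ℝ) 1 := by
  funext z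
  have h : HasFDerivAt (Flin μ)
      ((-2 * μ) • ContinuousLinearMap.proj (R := ℝ) (φ := fun _ : Fin 4 => ℝ) 2 +
        ContinuousLinearMap.proj (R := ℝ) (φ := fun _ : Fin 4 => ℝ) 1) z :=
    ((hasFDerivAt_apply 2 z).const_mul (-2 * μ)).add (hasFDerivAt_apply 1 z)
  simp [pd, h.fderiv]

theorem pd_one_Flin (μ : ℝ) : pd 1 (Flin μ) = fun _ => 1 := by
  simp [pd_Flin]

theorem pd_two_Flin (μ : ℝ) : pd 2 (Flin μ) = fun _ => -2 * μ := by
  simp [pd_Flin]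

theorem pd_three_Flin (μ : ℝ) : pd 3 (Flin μ) = fun _ => 0 := by
  simp [pd_Flin]

theorem Kf_Flin (μ : ℝ) : Kf (Flin μ) = fun _ => μ := by
  funext z
  simp only [Kf, pd_three_Flin, pd_two_Flin, Dop_const]
  ring

theorem Wf_Flin (μ : ℝ) : Wf (Flin μ) = fun _ => 1 := by
  funext z
  simp only [Wf, Kf_Flin, pd_three_Flin, pd_one_Flin, Dop_const]
  ring

theorem Zf_Flin (μ : ℝ) : Zf (Flin μ) = fun _ => 0 := by
  funext z
  simp [Zf, Wf_Flin, pd_three_Flin, Dop_const]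

/-- for `y''' = −2μy' + y` one has `K ≡ μ`, `W ≡ 1` (so `W ≠ 0`), `Z ≡ 0`,
`a[F] ≡ μ` and `2W_q² − 3W_{qq}W ≡ 0`, the conditions characterizing the homogeneous
models with symmetry algebra `ℝ² ⋉_μ ℝ³`. -/
theorem linear_ODE_contact_invariants (μ : ℝ) :
    ∀ z : Fin 4 → ℝ,
      Kf (Flin μ) z = μ ∧
      Wf (Flin μ) z = 1 ∧
      Wf (Flin μ) z ≠ 0 ∧
      Zf (Flin μ) z = 0 ∧
      aInv (Flin μ) z = μ ∧
      2 * (pd 3 (Wf (Flin μ)) z) ^ 2 -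
          3 * (pd 3 (pd 3 (Wf (Flin μ))) z) * Wf (Flin μ) z = 0 := by
  intro z
  refine ⟨by rw [Kf_Flin], by rw [Wf_Flin], by simp [Wf_Flin], by rw [Zf_Flin], ?_, ?_⟩
  · simp [aInv, Wf_Flin, Zf_Flin, Kf_Flin, Dop_const]
  · simp [Wf_Flin, pd_const]

end
end

section
/- Let F(x,y,p,q) = q^{3/2} on the open set U = {(x,y,p,q) ∈ ℝ⁴ : q > 0}. Then the Wünschmann invariant of the ODE y''' = (y'')^{3/2} vanishes identically: W = 𝒟(K) − (2/3)F_q·K + F_y ≡ 0 on U, where 𝒟 = ∂_x + p∂_y + q∂_p + F∂_q and K = (1/6)𝒟(F_q) − (1/9)F_q² − (1/2)F_p. (Explicitly, K = −q/8 and W = 0.) Thus y''' = (y'')^{3/2} satisfies the Wünschmann condition. -/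
noncomputable section

/-- The right-hand side `F = q^{3/2}` of `y''' = (y'')^{3/2}`. -/
def F11 (z : Fin 4 → ℝ) : ℝ := z 3 ^ ((3 : ℝ) / 2)

/-- The derivative of a function of `q = z 3` alone, from a local description. -/
theorem fderiv_of_eventuallyEq_comp_three {G : (Fin 4 → ℝ) → ℝ} {g : ℝ → ℝ} {g' : ℝ}
    {z : Fin 4 → ℝ} (hG : G =ᶠ[nhds z] fun w => g (w 3)) (hg : HasDerivAt g g' (z 3))
    (v : Fin 4 → ℝ) : fderiv ℝ G z v = g' * v 3 := by
  have h := (hg.comp_hasFDerivAt z (hasFDerivAt_apply (𝕜 := ℝ) (3 : Fin 4) z)).congr_of_eventuallyEq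
    hG
  rw [h.fderiv]
  simp

theorem eventually_three_pos {z : Fin 4 → ℝ} (hz : 0 < z 3) : ∀ᶠ w in nhds z, 0 < w 3 :=
  (continuous_apply (3 : Fin 4)).continuousAt.eventually (lt_mem_nhds hz)

theorem fderiv_F11 {z : Fin 4 → ℝ} (hz : 0 < z 3) (v : Fin 4 → ℝ) :
    fderiv ℝ F11 z v = 3 / 2 * √(z 3) * v 3 := by
  refine fderiv_of_eventuallyEq_comp_three (g := fun q => q ^ ((3 : ℝ) / 2)) (.of_forall fun _ => rfl)
    ?_ v
  convert Real.hasDerivAt_rpow_const (p := (3 : ℝ) / 2) (Or.inl hz.ne') using 1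
  rw [Real.sqrt_eq_rpow]
  norm_num

theorem F11_eq_mul_sqrt {z : Fin 4 → ℝ} (hz : 0 < z 3) : F11 z = z 3 * √(z 3) := by
  rw [F11, Real.sqrt_eq_rpow, ← Real.rpow_one_add' hz.le (by norm_num)]
  norm_num

theorem pd_three_F11 {z : Fin 4 → ℝ} (hz : 0 < z 3) : pd 3 F11 z = 3 / 2 * √(z 3) := by
  simp [pd, fderiv_F11 hz]

theorem Kf_F11 {z : Fin 4 → ℝ} (hz : 0 < z 3) : Kf F11 z = -(z 3) / 8 := by
  have hD : Dop F11 (pd 3 F11) z = 3 / 4 * z 3 := by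
    rw [Dop, fderiv_of_eventuallyEq_comp_three (g := fun q => 3 / 2 * √q)
      ((eventually_three_pos hz).mono fun w hw => pd_three_F11 hw)
      ((Real.hasDerivAt_sqrt hz.ne').const_mul _)]
    have hs : √(z 3) ≠ 0 := (Real.sqrt_pos.2 hz).ne'
    simp only [Dvec, F11_eq_mul_sqrt hz, Matrix.cons_val]
    field_simp
    norm_num
  have hp : pd 2 F11 z = 0 := by simp [pd, fderiv_F11 hz]
  rw [Kf, hD, hp, pd_three_F11 hz, mul_pow, Real.sq_sqrt hz.le]
  ring

/-- the ODE `y''' = (y'')^{3/2}` satisfies the Wünschmann condition: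
on `{q > 0}` one has `K = −q/8` and `W = 0`. -/
theorem wuenschmann_q32 :
    ∀ z : Fin 4 → ℝ, z 3 > 0 → Kf F11 z = -(z 3) / 8 ∧ Wf F11 z = 0 := by
  intro z hz
  refine ⟨Kf_F11 hz, ?_⟩
  have hD : Dop F11 (Kf F11) z = -1 / 8 * (z 3 * √(z 3)) := by
    rw [Dop, fderiv_of_eventuallyEq_comp_three (g := fun q => -q / 8)
      ((eventually_three_pos hz).mono fun w hw => Kf_F11 hw)
      ((hasDerivAt_id (z 3)).neg.div_const 8)]
    simp only [Dvec, F11_eq_mul_sqrt hz, Matrix.cons_val]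
  have hy : pd 1 F11 z = 0 := by simp [pd, fderiv_F11 hz]
  rw [Wf, hD, hy, pd_three_F11 hz, Kf_F11 hz]
  ring

end
end

section
/- Let F(x,y,p,q) = (q² + 1)^{3/2} on ℝ⁴. Then the Wünschmann invariant of the ODE y''' = ((y'')² + 1)^{3/2} vanishes identically: W = 𝒟(K) − (2/3)F_q·K + F_y ≡ 0 on ℝ⁴, where 𝒟 = ∂_x + p∂_y + q∂_p + F∂_q and K = (1/6)𝒟(F_q) − (1/9)F_q² − (1/2)F_p. (Explicitly, K = (q² + 1)/2 and W = 0.) Thus y''' = ((y'')² + 1)^{3/2} satisfies the Wünschmann condition. -/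
noncomputable section

/-- The right-hand side `F = (q² + 1)^{3/2}` of `y''' = ((y'')² + 1)^{3/2}`. -/
def F12 (z : Fin 4 → ℝ) : ℝ := (z 3 ^ 2 + 1) ^ ((3 : ℝ) / 2)

/-- Chain rule for a function of the coordinate `q` alone. -/
lemma fderiv_comp_coord_three {g : ℝ → ℝ} {g' : ℝ} {z : Fin 4 → ℝ} (h : HasDerivAt g g' (z 3))
    (v : Fin 4 → ℝ) : fderiv ℝ (fun w : Fin 4 → ℝ => g (w 3)) z v = g' * v 3 := by
  have hproj : HasFDerivAt (fun w : Fin 4 → ℝ => w 3)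
      (ContinuousLinearMap.proj (R := ℝ) (φ := fun _ : Fin 4 => ℝ) 3) z :=
    hasFDerivAt_apply 3 z
  have hcomp := h.comp_hasFDerivAt z hproj
  change fderiv ℝ (g ∘ fun w : Fin 4 → ℝ => w 3) z v = _
  rw [hcomp.fderiv]
  simp

lemma hasDerivAt_sqrt_sq_add_one (q : ℝ) :
    HasDerivAt (fun t : ℝ => √(t ^ 2 + 1)) (q / √(q ^ 2 + 1)) q := by
  have h := ((hasDerivAt_pow 2 q).add_const (1 : ℝ)).sqrt (by positivity)
  convert h using 1
  have : √(q ^ 2 + 1) ≠ 0 := by positivity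
  field_simp
  norm_num
  ring

lemma F12_eq : F12 = fun z => √(z 3 ^ 2 + 1) ^ 3 := by
  funext z
  rw [F12, Real.sqrt_eq_rpow, ← Real.rpow_mul_natCast (by positivity)]
  norm_num

lemma fderiv_F12 (z v : Fin 4 → ℝ) :
    fderiv ℝ F12 z v = 3 * z 3 * √(z 3 ^ 2 + 1) * v 3 := by
  rw [F12_eq]
  have h := (hasDerivAt_sqrt_sq_add_one (z 3)).pow 3
  refine (fderiv_comp_coord_three h v).trans ?_
  have : √(z 3 ^ 2 + 1) ≠ 0 := by positivity
  field_simp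
  norm_num
  ring

lemma pd_three_F12 : pd 3 F12 = fun z => 3 * z 3 * √(z 3 ^ 2 + 1) := by
  funext z
  simp [pd, fderiv_F12]

lemma Dop_pd_three_F12 (z : Fin 4 → ℝ) :
    Dop F12 (pd 3 F12) z = 3 * (z 3 ^ 2 + 1) * (2 * z 3 ^ 2 + 1) := by
  have h := ((hasDerivAt_id (z 3)).const_mul 3).mul (hasDerivAt_sqrt_sq_add_one (z 3))
  rw [Dop, pd_three_F12]
  refine (fderiv_comp_coord_three h _).trans ?_
  have hs : √(z 3 ^ 2 + 1) ≠ 0 := by positivity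
  have hsq : √(z 3 ^ 2 + 1) ^ 2 = z 3 ^ 2 + 1 := Real.sq_sqrt (by positivity)
  simp only [Dvec, F12_eq, id, Matrix.cons_val]
  field_simp
  rw [hsq]
  ring

lemma Kf_F12 : Kf F12 = fun z => (z 3 ^ 2 + 1) / 2 := by
  funext z
  have hsq : √(z 3 ^ 2 + 1) ^ 2 = z 3 ^ 2 + 1 := Real.sq_sqrt (by positivity)
  have hp : pd 2 F12 z = 0 := by simp [pd, fderiv_F12]
  rw [Kf, Dop_pd_three_F12, hp, pd_three_F12]
  simp only [mul_pow, hsq]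
  ring

lemma Dop_Kf_F12 (z : Fin 4 → ℝ) :
    Dop F12 (Kf F12) z = z 3 * √(z 3 ^ 2 + 1) ^ 3 := by
  have h := ((hasDerivAt_pow 2 (z 3)).add_const (1 : ℝ)).div_const 2
  rw [Dop, Kf_F12]
  refine (fderiv_comp_coord_three h _).trans ?_
  simp [Dvec, F12_eq]

/-- the ODE `y''' = ((y'')² + 1)^{3/2}` satisfies the Wünschmann
condition: `K = (q² + 1)/2` and `W = 0` on all of `ℝ⁴`. -/
theorem wuenschmann_q2plus1 :
    ∀ z : Fin 4 → ℝ, Kf F12 z = (z 3 ^ 2 + 1) / 2 ∧ Wf F12 z = 0 := by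
  intro z
  refine ⟨congrFun Kf_F12 z, ?_⟩
  have hsq : √(z 3 ^ 2 + 1) ^ 2 = z 3 ^ 2 + 1 := Real.sq_sqrt (by positivity)
  have hy : pd 1 F12 z = 0 := by simp [pd, fderiv_F12]
  rw [Wf, Dop_Kf_F12, Kf_F12, pd_three_F12, hy]
  linear_combination z 3 * √(z 3 ^ 2 + 1) * hsq

end
end

section
/- Let F(x,y,p,q) = 3q²p/(p² + 1) on ℝ⁴. Then the Wünschmann invariant of the ODE y''' = 3y'(y'')²/((y')² + 1) vanishes identically: with 𝒟 = ∂_x + p∂_y + q∂_p + F∂_q and K = (1/6)𝒟(F_q) − (1/9)F_q² − (1/2)F_p one has K = −q²/(2(p² + 1)) and W = 𝒟(K) − (2/3)F_q·K + F_y ≡ 0 on ℝ⁴. Thus y''' = 3y'(y'')²/((y')² + 1), the homogeneous model with point symmetry group O(4), satisfies the Wünschmann condition. -/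
noncomputable section

/-- The right-hand side `F = 3q²p/(p² + 1)` of `y''' = 3y'(y'')²/((y')² + 1)`. -/
def F14 (z : Fin 4 → ℝ) : ℝ := 3 * z 3 ^ 2 * z 2 / (z 2 ^ 2 + 1)

theorem fderiv_monomial_div (c : ℝ) (m n : ℕ) (z v : Fin 4 → ℝ) :
    fderiv ℝ (fun w : Fin 4 → ℝ => c * w 3 ^ m * w 2 ^ n / (w 2 ^ 2 + 1)) z v =
      (c * (m * z 3 ^ (m - 1) * v 3 * z 2 ^ n + z 3 ^ m * (n * z 2 ^ (n - 1) * v 2))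
          * (z 2 ^ 2 + 1) - c * z 3 ^ m * z 2 ^ n * (2 * z 2 * v 2)) / (z 2 ^ 2 + 1) ^ 2 := by
  have hp : HasFDerivAt (fun w : Fin 4 → ℝ => w 2)
      (ContinuousLinearMap.proj (R := ℝ) (φ := fun _ : Fin 4 => ℝ) 2) z := hasFDerivAt_apply 2 z
  have hq : HasFDerivAt (fun w : Fin 4 → ℝ => w 3)
      (ContinuousLinearMap.proj (R := ℝ) (φ := fun _ : Fin 4 => ℝ) 3) z := hasFDerivAt_apply 3 z
  have hz : z 2 ^ 2 + 1 ≠ 0 := by positivity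
  have hinv : HasFDerivAt (fun w : Fin 4 → ℝ => (w 2 ^ 2 + 1)⁻¹) _ z :=
    (hasDerivAt_inv hz).comp_hasFDerivAt z ((hp.pow 2).add_const 1)
  have h := (((hq.pow m).const_mul c).fun_mul (hp.pow n)).fun_mul hinv
  simp only [div_eq_mul_inv]
  rw [h.fderiv]
  simp
  field_simp
  ring

theorem pd_three_F14 : pd 3 F14 = fun w => 6 * w 3 ^ 1 * w 2 ^ 1 / (w 2 ^ 2 + 1) := by
  funext z
  have hz : z 2 ^ 2 + 1 ≠ 0 := by positivity
  have h := fderiv_monomial_div 3 2 1 z (Pi.single 3 1)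
  simp only [pow_one] at h
  unfold pd F14
  rw [h]
  simp
  field_simp
  ring

theorem pd_two_F14 (z : Fin 4 → ℝ) :
    pd 2 F14 z = 3 * z 3 ^ 2 * (1 - z 2 ^ 2) / (z 2 ^ 2 + 1) ^ 2 := by
  have h := fderiv_monomial_div 3 2 1 z (Pi.single 2 1)
  simp only [pow_one] at h
  unfold pd F14
  rw [h]
  simp
  ring

theorem pd_one_F14 (z : Fin 4 → ℝ) : pd 1 F14 z = 0 := by
  have h := fderiv_monomial_div 3 2 1 z (Pi.single 1 1)
  simp only [pow_one] at h
  unfold pd F14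
  rw [h]
  simp

theorem Kf_F14 : Kf F14 = fun w => (-1 / 2) * w 3 ^ 2 * w 2 ^ 0 / (w 2 ^ 2 + 1) := by
  funext z
  have hz : z 2 ^ 2 + 1 ≠ 0 := by positivity
  rw [Kf, Dop, pd_two_F14, pd_three_F14, fderiv_monomial_div]
  simp [Dvec, F14]
  field_simp
  ring

/-- the ODE `y''' = 3y'(y'')²/((y')² + 1)` (homogeneous model with point
symmetry group `O(4)`) satisfies the Wünschmann condition: `K = −q²/(2(p² + 1))` and
`W = 0` on all of `ℝ⁴`. -/
theorem wuenschmann_O4_model :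
    ∀ z : Fin 4 → ℝ,
      Kf F14 z = -(z 3 ^ 2) / (2 * (z 2 ^ 2 + 1)) ∧ Wf F14 z = 0 := by
  intro z
  have hz : z 2 ^ 2 + 1 ≠ 0 := by positivity
  refine ⟨?_, ?_⟩
  · rw [Kf_F14]
    field_simp
  · rw [Wf, Dop, pd_one_F14, pd_three_F14, Kf_F14, fderiv_monomial_div]
    simp [Dvec, F14]
    field_simp
    ring

end
end

section
/- Fix μ ∈ ℝ and let F(x,y,p,q) = μ(2qy − p²)^{3/2}/y² on the open set U = {(x,y,p,q) ∈ ℝ⁴ : y ≠ 0 and 2qy − p² > 0}. Then the Wünschmann invariant of the ODE y''' = μ(2y''y − (y')²)^{3/2}/y² vanishes identically: with 𝒟 = ∂_x + p∂_y + q∂_p + F∂_q and K = (1/6)𝒟(F_q) − (1/9)F_q² − (1/2)F_p one has K = (μ/y²)(p(2qy − p²)^{1/2} − (μ/2)(2qy − p²)) and W = 𝒟(K) − (2/3)F_q·K + F_y ≡ 0 on U. Thus this one-parameter family of ODEs satisfies the Wünschmann condition. -/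
noncomputable section

/-- The right-hand side `F = μ(2qy − p²)^{3/2}/y²`. -/
def F15 (μ : ℝ) (z : Fin 4 → ℝ) : ℝ :=
  μ * (2 * z 3 * z 1 - z 2 ^ 2) ^ ((3 : ℝ) / 2) / z 1 ^ 2

/-- The open set `y ≠ 0`, `2qy − p² > 0` on which the family is smooth. -/
def regularSet : Set (Fin 4 → ℝ) := {z | z 1 ≠ 0 ∧ 2 * z 3 * z 1 - z 2 ^ 2 > 0}

/-- The function `√(2qy − p²)`. -/
def rootDisc (z : Fin 4 → ℝ) : ℝ := Real.sqrt (2 * z 3 * z 1 - z 2 ^ 2)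

theorem isOpen_regularSet : IsOpen regularSet :=
  (isOpen_ne_fun (continuous_apply 1) continuous_const).inter
    (isOpen_lt continuous_const
      (by fun_prop : Continuous fun z : Fin 4 → ℝ => 2 * z 3 * z 1 - z 2 ^ 2))

theorem rootDisc_pos {z : Fin 4 → ℝ} (hz : z ∈ regularSet) : 0 < rootDisc z :=
  Real.sqrt_pos.2 hz.2

theorem rootDisc_sq {z : Fin 4 → ℝ} (hz : z ∈ regularSet) :
    rootDisc z ^ 2 = 2 * z 3 * z 1 - z 2 ^ 2 :=
  Real.sq_sqrt hz.2.le

theorem differentiableAt_rootDisc {z : Fin 4 → ℝ} (hz : z ∈ regularSet) :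
    DifferentiableAt ℝ rootDisc z :=
  DifferentiableAt.sqrt (by fun_prop) hz.2.ne'

theorem hasDerivAt_coord (z v : Fin 4 → ℝ) (i : Fin 4) :
    HasDerivAt (fun t : ℝ => (z + t • v) i) (v i) 0 := by
  simpa using ((hasDerivAt_id (0 : ℝ)).mul_const (v i)).const_add (z i)

theorem hasDerivAt_rootDisc {z : Fin 4 → ℝ} (hz : z ∈ regularSet) (v : Fin 4 → ℝ) :
    HasDerivAt (fun t : ℝ => rootDisc (z + t • v))
      ((z 3 * v 1 + z 1 * v 3 - z 2 * v 2) / rootDisc z) 0 := by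
  have hR := (((hasDerivAt_coord z v 3).const_mul 2).mul (hasDerivAt_coord z v 1)).sub
    ((hasDerivAt_coord z v 2).pow 2)
  have h := hR.sqrt (by simpa using hz.2.ne')
  have hs := (rootDisc_pos hz).ne'
  refine h.congr_deriv ?_
  simp only [Pi.sub_apply, Pi.mul_apply, Pi.pow_apply, zero_smul, add_zero]
  change _ / (2 * rootDisc z) = _
  field_simp
  push_cast
  ring

/-- The derivative of `G` on the regular set is the derivative along lines of any function
agreeing with it there. -/
theorem fderiv_apply_eq {G H : (Fin 4 → ℝ) → ℝ} (hGH : Set.EqOn G H regularSet)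
    {z : Fin 4 → ℝ} (hz : z ∈ regularSet) (hH : DifferentiableAt ℝ H z) {v : Fin 4 → ℝ} {c : ℝ}
    (hc : HasDerivAt (fun t : ℝ => H (z + t • v)) c 0) : fderiv ℝ G z v = c := by
  have he := hGH.eventuallyEq_of_mem (isOpen_regularSet.mem_nhds hz)
  rw [he.fderiv_eq, ← hH.lineDeriv_eq_fderiv]
  exact hc.deriv

theorem F15_eqOn (μ : ℝ) :
    Set.EqOn (F15 μ) (fun z => μ * rootDisc z ^ 3 / z 1 ^ 2) regularSet := by
  intro z hz
  have h : (2 * z 3 * z 1 - z 2 ^ 2) ^ ((3 : ℝ) / 2) = rootDisc z ^ 3 := by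
    rw [rootDisc, Real.sqrt_eq_rpow, ← Real.rpow_mul_natCast hz.2.le]
    norm_num
  simp only [F15, h]

theorem fderiv_F15 (μ : ℝ) {z : Fin 4 → ℝ} (hz : z ∈ regularSet) (v : Fin 4 → ℝ) :
    fderiv ℝ (F15 μ) z v =
      3 * μ * rootDisc z * (z 3 * v 1 + z 1 * v 3 - z 2 * v 2) / z 1 ^ 2 -
        2 * μ * rootDisc z ^ 3 * v 1 / z 1 ^ 3 := by
  have hy := hz.1
  have hs := (rootDisc_pos hz).ne'
  have hd := differentiableAt_rootDisc hz
  refine fderiv_apply_eq (F15_eqOn μ) hz (by fun_prop (disch := simpa using hy)) ?_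
  refine ((((hasDerivAt_rootDisc hz v).fun_pow 3).const_mul μ).fun_div
    ((hasDerivAt_coord z v 1).fun_pow 2) (by simpa using hy)).congr_deriv ?_
  simp only [zero_smul, add_zero]
  field_simp
  push_cast
  ring

theorem pd_three_F15_eqOn (μ : ℝ) :
    Set.EqOn (pd 3 (F15 μ)) (fun z => 3 * μ * rootDisc z / z 1) regularSet := by
  intro z hz
  have hy := hz.1
  simp only [pd, fderiv_F15 μ hz, Pi.single_apply]
  simp
  field_simp

theorem Dop_pd_three_F15 (μ : ℝ) {z : Fin 4 → ℝ} (hz : z ∈ regularSet) :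
    Dop (F15 μ) (pd 3 (F15 μ)) z =
      3 * μ * (μ * rootDisc z ^ 2 - z 2 * rootDisc z) / z 1 ^ 2 := by
  have hy := hz.1
  have hs := (rootDisc_pos hz).ne'
  have hd := differentiableAt_rootDisc hz
  refine fderiv_apply_eq (pd_three_F15_eqOn μ) hz (by fun_prop (disch := simpa using hy)) ?_
  refine (((hasDerivAt_rootDisc hz _).const_mul (3 * μ)).fun_div
    (hasDerivAt_coord z _ 1) (by simpa using hy)).congr_deriv ?_
  simp [Dvec, F15_eqOn μ hz]
  field_simp
  ring

theorem Kf_F15_eqOn (μ : ℝ) :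
    Set.EqOn (Kf (F15 μ))
      (fun z => (μ / z 1 ^ 2) * (z 2 * rootDisc z - (μ / 2) * rootDisc z ^ 2)) regularSet := by
  intro z hz
  have hy := hz.1
  simp only [Kf, Dop_pd_three_F15 μ hz, pd_three_F15_eqOn μ hz]
  simp only [pd, fderiv_F15 μ hz]
  simp
  field_simp
  ring

theorem Dop_Kf_F15 (μ : ℝ) {z : Fin 4 → ℝ} (hz : z ∈ regularSet) :
    Dop (F15 μ) (Kf (F15 μ)) z =
      μ * (2 * μ * z 2 * rootDisc z ^ 2 + z 1 * z 3 * rootDisc z - 2 * z 2 ^ 2 * rootDisc z -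
        μ ^ 2 * rootDisc z ^ 3) / z 1 ^ 3 := by
  have hy := hz.1
  have hs := (rootDisc_pos hz).ne'
  have hd := differentiableAt_rootDisc hz
  refine fderiv_apply_eq (Kf_F15_eqOn μ) hz (by fun_prop (disch := simpa using hy)) ?_
  refine (((hasDerivAt_const (0 : ℝ) μ).fun_div ((hasDerivAt_coord z _ 1).fun_pow 2)
    (by simpa using hy)).fun_mul (((hasDerivAt_coord z _ 2).fun_mul
      (hasDerivAt_rootDisc hz _)).fun_sub
        (((hasDerivAt_rootDisc hz _).fun_pow 2).const_mul (μ / 2)))).congr_deriv ?_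
  simp [Dvec, F15_eqOn μ hz]
  field_simp
  ring

/-- the family `y''' = μ(2y''y − (y')²)^{3/2}/y²` satisfies the Wünschmann
condition: on `{y ≠ 0, 2qy − p² > 0}` one has
`K = (μ/y²)(p√(2qy − p²) − (μ/2)(2qy − p²))` and `W = 0`. -/
theorem wuenschmann_mu_family (μ : ℝ) :
    ∀ z : Fin 4 → ℝ, z 1 ≠ 0 → 2 * z 3 * z 1 - z 2 ^ 2 > 0 →
      Kf (F15 μ) z =
          (μ / z 1 ^ 2) * (z 2 * Real.sqrt (2 * z 3 * z 1 - z 2 ^ 2) -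
            (μ / 2) * (2 * z 3 * z 1 - z 2 ^ 2)) ∧
      Wf (F15 μ) z = 0 := by
  intro z hy hR
  have hz : z ∈ regularSet := ⟨hy, hR⟩
  have hsq := rootDisc_sq hz
  refine ⟨by simp only [Kf_F15_eqOn μ hz, hsq]; rfl, ?_⟩
  simp only [Wf, Dop_Kf_F15 μ hz, Kf_F15_eqOn μ hz, pd_three_F15_eqOn μ hz]
  simp only [pd, fderiv_F15 μ hz]
  simp
  field_simp
  linear_combination (-2 * μ * rootDisc z) * hsq
end
end

section
/- Fix μ ∈ ℝ and let F(x,y,p,q) = 4μ(q − p²)^{3/2} + 6qp − 4p³ on the open set U = {(x,y,p,q) ∈ ℝ⁴ : q − p² > 0}. Then the Wünschmann invariant of the ODE y''' = 4μ(y'' − (y')²)^{3/2} + 6y''y' − 4(y')³ vanishes identically: with 𝒟 = ∂_x + p∂_y + q∂_p + F∂_q and K = (1/6)𝒟(F_q) − (1/9)F_q² − (1/2)F_p one has K = −2(μ² + 1)(q − p²) and W = 𝒟(K) − (2/3)F_q·K + F_y ≡ 0 on U. Thus this one-parameter family of ODEs satisfies the Wünschmann condition. -/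
noncomputable section

/-- The right-hand side `F = 4μ(q − p²)^{3/2} + 6qp − 4p³`. -/
def F16 (μ : ℝ) (z : Fin 4 → ℝ) : ℝ :=
  4 * μ * (z 3 - z 2 ^ 2) ^ ((3 : ℝ) / 2) + 6 * z 3 * z 2 - 4 * z 2 ^ 3

/-- The differential of the `i`-th coordinate function. -/
def coordCLM (i : Fin 4) : (Fin 4 → ℝ) →L[ℝ] ℝ := ContinuousLinearMap.proj i

lemma coordCLM_apply (i : Fin 4) (v : Fin 4 → ℝ) : coordCLM i v = v i := rfl

lemma hasFDerivAt_coord (i : Fin 4) (z : Fin 4 → ℝ) :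
    HasFDerivAt (fun w : Fin 4 → ℝ => w i) (coordCLM i) z :=
  (coordCLM i).hasFDerivAt

lemma hasFDerivAt_sub_sq (z : Fin 4 → ℝ) :
    HasFDerivAt (fun w : Fin 4 → ℝ => w 3 - w 2 ^ 2)
      (coordCLM 3 - (2 * z 2) • coordCLM 2) z := by
  refine ((hasFDerivAt_coord 3 z).sub ((hasFDerivAt_coord 2 z).pow 2)).congr_fderiv ?_
  ext v
  simp

lemma eventually_sub_sq_pos {z : Fin 4 → ℝ} (hz : 0 < z 3 - z 2 ^ 2) :
    ∀ᶠ w in nhds z, 0 < w 3 - w 2 ^ 2 :=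
  (hasFDerivAt_sub_sq z).continuousAt.eventually_const_lt hz

lemma rpow_three_halves {u : ℝ} (hu : 0 < u) : u ^ ((3 : ℝ) / 2) = √u ^ 3 := by
  rw [Real.sqrt_eq_rpow, ← Real.rpow_natCast, ← Real.rpow_mul hu.le]
  norm_num

lemma F16_eq (μ : ℝ) {z : Fin 4 → ℝ} (hz : 0 < z 3 - z 2 ^ 2) :
    F16 μ z = 4 * μ * √(z 3 - z 2 ^ 2) ^ 3 + 6 * z 3 * z 2 - 4 * z 2 ^ 3 := by
  rw [F16, rpow_three_halves hz]

lemma hasFDerivAt_F16 (μ : ℝ) {z : Fin 4 → ℝ} (hz : 0 < z 3 - z 2 ^ 2) :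
    HasFDerivAt (F16 μ)
      ((6 * μ * √(z 3 - z 2 ^ 2) + 6 * z 2) • coordCLM 3 +
        (-12 * μ * √(z 3 - z 2 ^ 2) * z 2 + 6 * z 3 - 12 * z 2 ^ 2) • coordCLM 2) z := by
  have h := ((((hasFDerivAt_sub_sq z).rpow_const (p := (3 : ℝ) / 2) (Or.inl hz.ne')).const_mul
    (4 * μ)).add (((hasFDerivAt_coord 3 z).const_mul 6).mul (hasFDerivAt_coord 2 z))).sub
    (((hasFDerivAt_coord 2 z).pow 3).const_mul 4)
  refine h.congr_fderiv ?_
  ext v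
  have e : (z 3 - z 2 ^ 2) ^ ((3 : ℝ) / 2 - 1) = √(z 3 - z 2 ^ 2) := by
    rw [Real.sqrt_eq_rpow]
    norm_num
  simp [e]
  ring

lemma pd_one_F16 (μ : ℝ) {z : Fin 4 → ℝ} (hz : 0 < z 3 - z 2 ^ 2) : pd 1 (F16 μ) z = 0 := by
  simp [pd, (hasFDerivAt_F16 μ hz).fderiv, coordCLM_apply]

lemma pd_two_F16 (μ : ℝ) {z : Fin 4 → ℝ} (hz : 0 < z 3 - z 2 ^ 2) :
    pd 2 (F16 μ) z = -12 * μ * √(z 3 - z 2 ^ 2) * z 2 + 6 * z 3 - 12 * z 2 ^ 2 := by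
  simp [pd, (hasFDerivAt_F16 μ hz).fderiv, coordCLM_apply]

lemma pd_three_F16 (μ : ℝ) {z : Fin 4 → ℝ} (hz : 0 < z 3 - z 2 ^ 2) :
    pd 3 (F16 μ) z = 6 * μ * √(z 3 - z 2 ^ 2) + 6 * z 2 := by
  simp [pd, (hasFDerivAt_F16 μ hz).fderiv, coordCLM_apply]

lemma Dop_pd_three_F16 (μ : ℝ) {z : Fin 4 → ℝ} (hz : 0 < z 3 - z 2 ^ 2) :
    Dop (F16 μ) (pd 3 (F16 μ)) z =
      12 * μ ^ 2 * (z 3 - z 2 ^ 2) + 12 * μ * z 2 * √(z 3 - z 2 ^ 2) + 6 * z 3 := by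
  have hev : pd 3 (F16 μ) =ᶠ[nhds z] fun w => 6 * μ * √(w 3 - w 2 ^ 2) + 6 * w 2 :=
    (eventually_sub_sq_pos hz).mono fun w hw => pd_three_F16 μ hw
  have h := (((hasFDerivAt_sub_sq z).sqrt hz.ne').const_mul (6 * μ)).fun_add
    ((hasFDerivAt_coord 2 z).const_mul 6)
  have hs : 0 < √(z 3 - z 2 ^ 2) := Real.sqrt_pos.2 hz
  have hsq : √(z 3 - z 2 ^ 2) ^ 2 = z 3 - z 2 ^ 2 := Real.sq_sqrt hz.le
  rw [Dop, hev.fderiv_eq, h.fderiv]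
  simp only [Dvec, F16_eq μ hz, add_apply, smul_apply,
    sub_apply, coordCLM_apply, smul_eq_mul, Matrix.cons_val]
  generalize √(z 3 - z 2 ^ 2) = s at hs hsq ⊢
  have hq : z 3 = s ^ 2 + z 2 ^ 2 := by linarith
  rw [hq]
  field_simp
  ring

lemma Kf_F16 (μ : ℝ) {z : Fin 4 → ℝ} (hz : 0 < z 3 - z 2 ^ 2) :
    Kf (F16 μ) z = -2 * (μ ^ 2 + 1) * (z 3 - z 2 ^ 2) := by
  rw [Kf, Dop_pd_three_F16 μ hz, pd_three_F16 μ hz, pd_two_F16 μ hz]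
  linear_combination (-4 * μ ^ 2) * Real.sq_sqrt hz.le

lemma Dop_Kf_F16 (μ : ℝ) {z : Fin 4 → ℝ} (hz : 0 < z 3 - z 2 ^ 2) :
    Dop (F16 μ) (Kf (F16 μ)) z = -2 * (μ ^ 2 + 1) * (F16 μ z - 2 * z 2 * z 3) := by
  have hev : Kf (F16 μ) =ᶠ[nhds z] fun w => -2 * (μ ^ 2 + 1) * (w 3 - w 2 ^ 2) :=
    (eventually_sub_sq_pos hz).mono fun w hw => Kf_F16 μ hw
  rw [Dop, hev.fderiv_eq, ((hasFDerivAt_sub_sq z).const_mul _).fderiv]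
  simp [Dvec, coordCLM_apply]

/-- the family `y''' = 4μ(y'' − (y')²)^{3/2} + 6y''y' − 4(y')³` satisfies
the Wünschmann condition: on `{q − p² > 0}` one has `K = −2(μ² + 1)(q − p²)` and
`W = 0`. -/
theorem wuenschmann_mu_family2 (μ : ℝ) :
    ∀ z : Fin 4 → ℝ, z 3 - z 2 ^ 2 > 0 →
      Kf (F16 μ) z = -2 * (μ ^ 2 + 1) * (z 3 - z 2 ^ 2) ∧ Wf (F16 μ) z = 0 := by
  intro z hz
  refine ⟨Kf_F16 μ hz, ?_⟩
  rw [Wf, Dop_Kf_F16 μ hz, Kf_F16 μ hz, pd_three_F16 μ hz, pd_one_F16 μ hz, F16_eq μ hz]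
  linear_combination (-8 * (μ ^ 2 + 1) * μ * √(z 3 - z 2 ^ 2)) * Real.sq_sqrt hz.le

end
end
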